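/- Let f : ℝⁿ → ℝ be continuous with compact support. Then there exists a constant c = c(f) > 0 such that for every unimodular lattice Δ ⊂ ℝⁿ and every ξ ∈ ℝⁿ, |Σ_{v ∈ Δ+ξ} f(v)| < c·α(Δ). -/

import Mathlib

open MeasureTheory Filter Topology Matrix

noncomputable section

def eNorm {n : ℕ} (x : Fin n → ℝ) : ℝ := Real.sqrt (∑ i, x i ^ 2)

def intCast {n : ℕ} (x : Fin n → ℤ) : Fin n → ℝ := fun i => (x i : ℝ)

def ip {n : ℕ} (x y : Fin n → ℝ) : ℝ := ∑ i, x i * y i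

/-- The Gram matrix of a tuple of vectors. -/
def gram {n k : ℕ} (w : Fin k → (Fin n → ℝ)) : Matrix (Fin k) (Fin k) ℝ :=
  fun a b => ip (w a) (w b)

/-- The covolume `‖w₁ ∧ ⋯ ∧ w_k‖` of the parallelepiped spanned by `w`. -/
def covol {n k : ℕ} (w : Fin k → (Fin n → ℝ)) : ℝ := Real.sqrt (gram w).det

/-- The lattice `gℤⁿ`. -/
def latt {n : ℕ} (g : Matrix (Fin n) (Fin n) ℝ) : Set (Fin n → ℝ) :=
  {v | ∃ m : Fin n → ℤ, v = g *ᵥ intCast m}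

/-- The set of values `1/d(L)` over `Δ`-rational subspaces `L` of dimension `1 ≤ i ≤ n`,
where `d(L)` is the covolume of `L ∩ Δ` in `L`, computed from a `ℤ`-basis `w` of `L ∩ Δ`. -/
def alphaSet {n : ℕ} (Δ : Set (Fin n → ℝ)) : Set ℝ :=
  {r | ∃ (i : ℕ), 1 ≤ i ∧ i ≤ n ∧ ∃ w : Fin i → (Fin n → ℝ),
    (∀ a, w a ∈ Δ) ∧ LinearIndependent ℝ w ∧
    (∀ v ∈ Δ, v ∈ Submodule.span ℝ (Set.range w) →
      ∃ c : Fin i → ℤ, v = ∑ a, (c a : ℝ) • w a) ∧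
    r = (covol w)⁻¹}

/-- `α(Δ) = max_{0 ≤ i ≤ n} α_i(Δ)`, with `α₀ = 1`. -/
def alphaFn {n : ℕ} (Δ : Set (Fin n → ℝ)) : ℝ := sSup (alphaSet Δ ∪ {1})

section InnerProduct

variable {E : Type*} [NormedAddCommGroup E] [InnerProductSpace ℝ E]

open scoped RealInnerProductSpace

/-- The projection along `v` onto its orthogonal complement. -/
def projPerp (v : E) : E →ₗ[ℝ] E :=
  LinearMap.id - ((⟪v, v⟫⁻¹ • innerₛₗ ℝ v).smulRight v)

lemma projPerp_apply (v x : E) : projPerp v x = x - (⟪v, v⟫⁻¹ * ⟪v, x⟫) • v := by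
  simp [projPerp]

lemma inner_projPerp {v : E} (hv : v ≠ 0) (x : E) : ⟪v, projPerp v x⟫ = 0 := by
  have h : ⟪v, v⟫ ≠ 0 := inner_self_ne_zero.mpr hv
  rw [projPerp_apply, inner_sub_right, inner_smul_right]
  field_simp
  ring

lemma projPerp_inner {v : E} (hv : v ≠ 0) (x : E) : ⟪projPerp v x, v⟫ = 0 := by
  rw [real_inner_comm, inner_projPerp hv]

lemma projPerp_self {v : E} (hv : v ≠ 0) : projPerp v v = 0 := by
  have h : ⟪v, v⟫ ≠ 0 := inner_self_ne_zero.mpr hv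
  rw [projPerp_apply, inv_mul_cancel₀ h, one_smul, sub_self]

lemma norm_projPerp_le {v : E} (hv : v ≠ 0) (x : E) : ‖projPerp v x‖ ≤ ‖x‖ := by
  have h := norm_add_sq_eq_norm_sq_add_norm_sq_of_inner_eq_zero
    (projPerp v x) ((⟪v, v⟫⁻¹ * ⟪v, x⟫) • v)
    (by rw [inner_smul_right, projPerp_inner hv, mul_zero])
  rw [projPerp_apply, sub_add_cancel, ← projPerp_apply] at h
  nlinarith [norm_nonneg x, norm_nonneg (projPerp v x),
    mul_self_nonneg ‖(⟪v, v⟫⁻¹ * ⟪v, x⟫) • v‖]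

lemma det_gram_finCons {k : ℕ} {v : E} (hv : v ≠ 0) (w : Fin k → E) :
    (Matrix.gram ℝ (Fin.cons v w : Fin (k + 1) → E)).det =
      ‖v‖ ^ 2 * (Matrix.gram ℝ (projPerp v ∘ w)).det := by
  set B : Matrix (Fin (k + 1)) (Fin (k + 1)) ℝ :=
    Matrix.of fun i j => ⟪(Fin.cons v (projPerp v ∘ w) : Fin (k + 1) → E) i,
      (Fin.cons v w : Fin (k + 1) → E) j⟫ with hB
  have h1 : (Matrix.gram ℝ (Fin.cons v w : Fin (k + 1) → E)).det = B.det := by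
    refine Matrix.det_eq_of_forall_row_eq_smul_add_const
      (Fin.cons 0 fun i => ⟪v, v⟫⁻¹ * ⟪v, w i⟫) 0 (by simp) fun i j => ?_
    refine Fin.cases ?_ (fun i => ?_) i
    · simp [hB]
    · simp [hB, projPerp_apply, inner_sub_left, inner_smul_left]
  have h2 : B.submatrix Fin.succ Fin.succ = Matrix.gram ℝ (projPerp v ∘ w) := by
    ext i j
    simp only [hB, Matrix.submatrix_apply, Matrix.of_apply, Fin.cons_succ, Matrix.gram_apply,
      Function.comp_apply]
    conv_rhs => rw [projPerp_apply v (w j), inner_sub_right, inner_smul_right, projPerp_inner hv,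
      mul_zero, sub_zero]
  rw [h1, Matrix.det_succ_column_zero, Fin.sum_univ_succ, Finset.sum_eq_zero]
  · have : (Fin.succAbove (0 : Fin (k + 1))) = Fin.succ := by ext i; simp
    rw [this, h2]
    simp [hB]
  · intro i _
    have : B i.succ 0 = 0 := by
      simp [hB, projPerp_inner hv]
    rw [this]; simp

end InnerProduct

lemma Matrix.PosSemidef.one_le_det_one_add {k : Type*} [Fintype k] [DecidableEq k]
    {Q : Matrix k k ℝ} (hQ : Q.PosSemidef) : 1 ≤ (1 + Q).det := by
  have hH : (1 + Q).IsHermitian := Matrix.isHermitian_one.add hQ.isHermitian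
  rw [hH.det_eq_prod_eigenvalues]
  refine Finset.one_le_prod fun i _ => ?_
  have hnorm : star (hH.eigenvectorBasis i).ofLp ⬝ᵥ (hH.eigenvectorBasis i).ofLp = 1 := by
    have h := real_inner_self_eq_norm_sq (hH.eigenvectorBasis i)
    rwa [EuclideanSpace.inner_eq_star_dotProduct, dotProduct_comm,
      hH.eigenvectorBasis.orthonormal.norm_eq_one, one_pow] at h
  have hnn := hQ.dotProduct_mulVec_nonneg (hH.eigenvectorBasis i).ofLp
  have h := hH.eigenvalues_eq i
  rw [Matrix.add_mulVec, Matrix.one_mulVec, dotProduct_add, hnorm] at h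
  simp only [RCLike.re_to_real] at h
  simp only [RCLike.ofReal_real_eq_id, id]
  linarith

open scoped MatrixOrder in
lemma Matrix.PosDef.det_le_det_add {k : Type*} [Fintype k] [DecidableEq k]
    {A P : Matrix k k ℝ} (hA : A.PosDef) (hP : P.PosSemidef) : A.det ≤ (A + P).det := by
  obtain ⟨C, rfl⟩ := CStarAlgebra.nonneg_iff_eq_star_mul_self.mp hA.posSemidef.nonneg
  have hC : IsUnit C.det := by
    have := hA.det_pos.ne'
    rw [Matrix.det_mul] at this
    exact (right_ne_zero_of_mul this).isUnit
  have hCinv : C⁻¹ * C = 1 := Matrix.nonsing_inv_mul C hC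
  have key : star C * C + P = star C * (1 + (C⁻¹)ᴴ * P * C⁻¹) * C := by
    have h : star C * (C⁻¹)ᴴ = 1 := by
      rw [Matrix.star_eq_conjTranspose, ← Matrix.conjTranspose_mul, hCinv,
        Matrix.conjTranspose_one]
    calc star C * C + P = star C * C + (star C * (C⁻¹)ᴴ) * P * (C⁻¹ * C) := by
          rw [h, hCinv, one_mul, mul_one]
      _ = _ := by noncomm_ring
  have h1 := (hP.conjTranspose_mul_mul_same C⁻¹).one_le_det_one_add
  have h0 : 0 ≤ (star C * C).det := hA.det_pos.le
  have hdet : (star C * (1 + (C⁻¹)ᴴ * P * C⁻¹) * C).det =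
      (star C * C).det * (1 + (C⁻¹)ᴴ * P * C⁻¹).det := by
    simp only [Matrix.det_mul]
    ring
  rw [key, hdet]
  exact le_mul_of_one_le_right h0 h1

section Counting

variable {E : Type*} [NormedAddCommGroup E] [InnerProductSpace ℝ E]

open scoped RealInnerProductSpace

/-- A shortest nonzero vector of a subgroup generates the intersection of the subgroup with the
line through it. -/
lemma exists_int_smul_of_projPerp_eq_zero {Λ : AddSubgroup E} {v : E} (hvΛ : v ∈ Λ) (hv : v ≠ 0)
    (hmin : ∀ x ∈ Λ, x ≠ 0 → ‖v‖ ≤ ‖x‖) {x : E} (hx : x ∈ Λ) (hPx : projPerp v x = 0) :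
    ∃ j : ℤ, x = (j : ℝ) • v := by
  rw [projPerp_apply, sub_eq_zero] at hPx
  set t := ⟪v, v⟫⁻¹ * ⟪v, x⟫ with ht
  refine ⟨⌊t⌋, ?_⟩
  by_contra hne
  have hmem : x - (⌊t⌋ : ℝ) • v ∈ Λ := by
    rw [Int.cast_smul_eq_zsmul]
    exact Λ.sub_mem hx (Λ.zsmul_mem hvΛ _)
  have h := hmin _ hmem (sub_ne_zero.mpr hne)
  have heq : x - (⌊t⌋ : ℝ) • v = Int.fract t • v := by
    rw [← Int.self_sub_floor, sub_smul, ← hPx]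
  rw [heq, norm_smul, Real.norm_eq_abs, Int.abs_fract] at h
  nlinarith [Int.fract_lt_one t, norm_pos_iff.mpr hv]

lemma exists_projPerp_eq_norm_le {Λ : AddSubgroup E} {v : E} (hvΛ : v ∈ Λ) (hv : v ≠ 0)
    {x : E} (hx : x ∈ Λ) :
    ∃ x' ∈ Λ, projPerp v x' = projPerp v x ∧ ‖x'‖ ≤ ‖projPerp v x‖ + ‖v‖ := by
  set t := ⟪v, v⟫⁻¹ * ⟪v, x⟫ with ht
  refine ⟨x - (⌊t⌋ : ℝ) • v, ?_, ?_, ?_⟩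
  · rw [Int.cast_smul_eq_zsmul]
    exact Λ.sub_mem hx (Λ.zsmul_mem hvΛ _)
  · rw [map_sub, map_smul, projPerp_self hv, smul_zero, sub_zero]
  · have heq : x - (⌊t⌋ : ℝ) • v = projPerp v x + Int.fract t • v := by
      rw [projPerp_apply, ← ht, ← Int.self_sub_floor, sub_smul]
      abel
    rw [heq]
    refine (norm_add_le _ _).trans ?_
    rw [norm_smul, Real.norm_eq_abs, Int.abs_fract]
    gcongr
    exact mul_le_of_le_one_left (norm_nonneg _) (Int.fract_lt_one t).le

lemma finite_setOf_norm_add_le {E : Type*} [NormedAddCommGroup E] {Λ : AddSubgroup E}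
    (hΛ : ∀ r, {x | x ∈ Λ ∧ ‖x‖ ≤ r}.Finite) (ξ : E) (R : ℝ) :
    {x | x ∈ Λ ∧ ‖x + ξ‖ ≤ R}.Finite := by
  refine (hΛ (R + ‖ξ‖)).subset fun x hx => ⟨hx.1, ?_⟩
  have h := norm_sub_le (x + ξ) ξ
  rw [add_sub_cancel_right] at h
  linarith [hx.2]

/-- Projecting along a shortest vector `v` of a discrete subgroup decreases the number of points
in a translated ball by a factor of at most `6 * R / ‖v‖`. -/
lemma ncard_mul_norm_le {Λ : AddSubgroup E} (hΛ : ∀ r, {x | x ∈ Λ ∧ ‖x‖ ≤ r}.Finite)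
    {v : E} (hvΛ : v ∈ Λ) (hv : v ≠ 0) (hmin : ∀ x ∈ Λ, x ≠ 0 → ‖v‖ ≤ ‖x‖) {R : ℝ}
    (hvR : ‖v‖ ≤ 2 * R)
    (hPΛ : ∀ r, {x | x ∈ Λ.map (projPerp v).toAddMonoidHom ∧ ‖x‖ ≤ r}.Finite) (ξ : E) :
    ({x | x ∈ Λ ∧ ‖x + ξ‖ ≤ R}.ncard : ℝ) * ‖v‖ ≤
      6 * R * {y | y ∈ Λ.map (projPerp v).toAddMonoidHom ∧ ‖y + projPerp v ξ‖ ≤ R}.ncard := by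
  classical
  have hvpos : 0 < ‖v‖ := norm_pos_iff.mpr hv
  have hS := finite_setOf_norm_add_le hΛ ξ R
  have hT := finite_setOf_norm_add_le hPΛ (projPerp v ξ) R
  rw [Set.ncard_eq_toFinset_card _ hS, Set.ncard_eq_toFinset_card _ hT]
  set k : ℕ := ⌊2 * R / ‖v‖⌋₊ with hk
  have hkle : (k : ℝ) ≤ 2 * R / ‖v‖ := Nat.floor_le (by positivity [hvpos.le.trans hvR])
  have himg : hS.toFinset.image (projPerp v) ⊆ hT.toFinset := by
    intro y hy
    obtain ⟨x, hx, rfl⟩ := Finset.mem_image.mp hy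
    rw [Set.Finite.mem_toFinset] at hx ⊢
    refine ⟨⟨x, hx.1, rfl⟩, ?_⟩
    rw [← map_add]
    exact (norm_projPerp_le hv _).trans hx.2
  have hfib : hS.toFinset.card ≤ (2 * k + 1) * (hS.toFinset.image (projPerp v)).card := by
    refine Finset.card_le_mul_card_image _ _ fun y hy => ?_
    obtain ⟨x₀, hx₀, rfl⟩ := Finset.mem_image.mp hy
    have hsub : {a ∈ hS.toFinset | projPerp v a = projPerp v x₀} ⊆
        (Finset.Icc (-(k : ℤ)) k).image fun j : ℤ => x₀ + (j : ℝ) • v := by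
      intro x hx
      rw [Finset.mem_filter, Set.Finite.mem_toFinset] at hx
      rw [Set.Finite.mem_toFinset] at hx₀
      obtain ⟨j, hj⟩ := exists_int_smul_of_projPerp_eq_zero hvΛ hv hmin
        (Λ.sub_mem hx.1.1 hx₀.1) (by rw [map_sub, hx.2, sub_self])
      have hnorm : ‖x - x₀‖ ≤ 2 * R := by
        have h := norm_sub_le (x + ξ) (x₀ + ξ)
        rw [add_sub_add_right_eq_sub] at h
        linarith [hx.1.2, hx₀.2]
      rw [hj, norm_smul, Real.norm_eq_abs, ← le_div_iff₀ hvpos] at hnorm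
      have hjk : |j| ≤ (k : ℤ) := by
        have : (j.natAbs : ℝ) ≤ 2 * R / ‖v‖ := by
          rwa [Nat.cast_natAbs, Int.cast_abs]
        rw [Int.abs_eq_natAbs]
        exact_mod_cast Nat.le_floor this
      refine Finset.mem_image.mpr ⟨j, Finset.mem_Icc.mpr (abs_le.mp hjk), ?_⟩
      rw [← hj]
      abel
    refine (Finset.card_le_card hsub).trans (Finset.card_image_le.trans ?_)
    rw [Int.card_Icc]
    omega
  have hcard : (hS.toFinset.card : ℝ) ≤ (2 * k + 1) * hT.toFinset.card := by
    exact_mod_cast hfib.trans (Nat.mul_le_mul_left _ (Finset.card_le_card himg))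
  have hcoef : (2 * k + 1 : ℝ) * ‖v‖ ≤ 6 * R := by
    rw [le_div_iff₀ hvpos] at hkle
    linarith
  calc (hS.toFinset.card : ℝ) * ‖v‖ ≤ (2 * k + 1) * hT.toFinset.card * ‖v‖ := by gcongr
    _ = (2 * k + 1) * ‖v‖ * hT.toFinset.card := by ring
    _ ≤ _ := by gcongr

/-- The number of points of a translated discrete subgroup in a ball is at most a constant divided
by the covolume of some primitive sublattice. -/
theorem exists_primitive_ncard_mul_sqrt_det_gram_le [FiniteDimensional ℝ E] (R : ℝ) (d : ℕ)
    (Λ : AddSubgroup E) (hΛ : ∀ r, {x | x ∈ Λ ∧ ‖x‖ ≤ r}.Finite)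
    (hd : Module.finrank ℝ (Submodule.span ℝ (Λ : Set E)) ≤ d) :
    ∃ (i : ℕ) (w : Fin i → E), (∀ a, w a ∈ Λ) ∧ LinearIndependent ℝ w ∧
      (∀ x ∈ Λ, x ∈ Submodule.span ℝ (Set.range w) →
        ∃ c : Fin i → ℤ, x = ∑ a, (c a : ℝ) • w a) ∧
      ∀ ξ : E, ({x | x ∈ Λ ∧ ‖x + ξ‖ ≤ R}.ncard : ℝ) * √(Matrix.gram ℝ w).det ≤
        (6 * R) ^ i := by
  induction d using Nat.strong_induction_on generalizing Λ with
  | _ d ih =>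
  by_cases hex : ∃ v ∈ Λ, v ≠ 0 ∧ ‖v‖ ≤ 2 * R
  · obtain ⟨v₁, hv₁, hv₁0, hv₁R⟩ := hex
    have hfin : {x | x ∈ Λ ∧ x ≠ 0 ∧ ‖x‖ ≤ 2 * R}.Finite :=
      (hΛ (2 * R)).subset fun x hx => ⟨hx.1, hx.2.2⟩
    obtain ⟨v, ⟨hvΛ, hv, hvR⟩, hvmin⟩ :=
      Set.exists_min_image _ (fun x : E => ‖x‖) hfin ⟨v₁, hv₁, hv₁0, hv₁R⟩
    have hmin : ∀ x ∈ Λ, x ≠ 0 → ‖v‖ ≤ ‖x‖ := fun x hx hx0 => by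
      by_cases h : ‖x‖ ≤ 2 * R
      · exact hvmin x ⟨hx, hx0, h⟩
      · linarith
    have hPΛ : ∀ r, {x | x ∈ Λ.map (projPerp v).toAddMonoidHom ∧ ‖x‖ ≤ r}.Finite := by
      intro r
      refine ((hΛ (r + ‖v‖)).image (projPerp v)).subset ?_
      rintro _ ⟨⟨x, hx, rfl⟩, hxr⟩
      obtain ⟨x', hx', hPx', hnx'⟩ := exists_projPerp_eq_norm_le hvΛ hv hx
      refine ⟨x', ⟨hx', hnx'.trans ?_⟩, hPx'⟩
      gcongr
      exact hxr
    have hlt : Submodule.span ℝ (Λ.map (projPerp v).toAddMonoidHom : Set E) <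
        Submodule.span ℝ (Λ : Set E) := by
      have hvs : v ∈ Submodule.span ℝ (Λ : Set E) := Submodule.subset_span hvΛ
      refine SetLike.lt_iff_le_and_exists.mpr ⟨Submodule.span_le.mpr ?_, v, hvs, fun hmem => ?_⟩
      · rintro _ ⟨x, hx, rfl⟩
        change projPerp v x ∈ _
        rw [projPerp_apply]
        exact Submodule.sub_mem _ (Submodule.subset_span hx) (Submodule.smul_mem _ _ hvs)
      · have hle : Submodule.span ℝ (Λ.map (projPerp v).toAddMonoidHom : Set E) ≤
            LinearMap.ker (innerₛₗ ℝ v) := by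
          refine Submodule.span_le.mpr ?_
          rintro _ ⟨x, hx, rfl⟩
          exact inner_projPerp hv x
        exact hv (inner_self_eq_zero.mp (hle hmem))
    obtain ⟨i, w', hw'Λ, hw'li, hw'prim, hw'card⟩ :=
      ih _ ((Submodule.finrank_lt_finrank_of_lt hlt).trans_le hd) _ hPΛ le_rfl
    choose w hwΛ hw using hw'Λ
    have hPw : projPerp v ∘ w = w' := funext hw
    refine ⟨i + 1, Fin.cons v w, ?_, ?_, ?_, ?_⟩
    · exact fun a => Fin.cases hvΛ hwΛ a
    · have hdet : (Matrix.gram ℝ (Fin.cons v w : Fin (i + 1) → E)).det ≠ 0 := by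
        rw [det_gram_finCons hv, hPw]
        exact mul_ne_zero (pow_ne_zero _ (norm_ne_zero_iff.mpr hv))
          (Matrix.det_gram_ne_zero_iff_linearIndependent.mpr hw'li)
      exact Matrix.linearIndependent_of_det_gram_ne_zero hdet
    · intro x hx hxs
      have hPx : projPerp v x ∈ Submodule.span ℝ (Set.range w') := by
        have h := Submodule.mem_map_of_mem (f := projPerp v) hxs
        rw [Submodule.map_span, ← Set.range_comp, Fin.comp_cons, hPw, projPerp_self hv,
          Fin.range_cons, Submodule.span_insert_zero] at h
        exact h
      obtain ⟨c, hc⟩ := hw'prim _ ⟨x, hx, rfl⟩ hPx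
      obtain ⟨j, hj⟩ := exists_int_smul_of_projPerp_eq_zero hvΛ hv hmin
        (x := x - ∑ a, (c a : ℝ) • w a)
        (Λ.sub_mem hx (sum_mem fun a _ => by
          rw [Int.cast_smul_eq_zsmul]
          exact Λ.zsmul_mem (hwΛ a) _))
        (by
          have hc' : projPerp v x = _ := hc
          rw [map_sub, map_sum, hc', sub_eq_zero, ← hPw]
          simp)
      refine ⟨Fin.cons j c, ?_⟩
      rw [Fin.sum_univ_succ]
      simp only [Fin.cons_zero, Fin.cons_succ]
      rw [← hj, sub_add_cancel]
    · intro ξ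
      rw [det_gram_finCons hv, hPw, Real.sqrt_mul (sq_nonneg _), Real.sqrt_sq (norm_nonneg _),
        ← mul_assoc, pow_succ']
      have hR : 0 ≤ R := by linarith [norm_nonneg v]
      refine (mul_le_mul_of_nonneg_right (ncard_mul_norm_le hΛ hvΛ hv hmin hvR hPΛ ξ)
        (Real.sqrt_nonneg _)).trans ?_
      rw [mul_assoc]
      exact mul_le_mul_of_nonneg_left (hw'card _) (by positivity)
  · push Not at hex
    refine ⟨0, Fin.elim0, fun a => a.elim0, linearIndependent_empty_type, ?_, fun ξ => ?_⟩
    · intro x _ hxs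
      rw [Set.range_eq_empty, Submodule.span_empty, Submodule.mem_bot] at hxs
      exact ⟨Fin.elim0, by simp [hxs]⟩
    · rw [Matrix.det_fin_zero, Real.sqrt_one, mul_one, pow_zero]
      have : {x | x ∈ Λ ∧ ‖x + ξ‖ ≤ R}.ncard ≤ 1 := by
        refine (Set.ncard_le_one (finite_setOf_norm_add_le hΛ ξ R)).mpr fun x hx y hy => ?_
        by_contra hne
        have h1 := hex _ (Λ.sub_mem hx.1 hy.1) (sub_ne_zero.mpr hne)
        have h := norm_sub_le (x + ξ) (y + ξ)
        rw [add_sub_add_right_eq_sub] at h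
        linarith [hx.2, hy.2]
      exact_mod_cast this

end Counting

section Euclidean

variable {n : ℕ}

lemma covol_eq_sqrt_det_gram {k : ℕ} (w : Fin k → (Fin n → ℝ)) :
    covol w = √(Matrix.gram ℝ fun a => WithLp.toLp 2 (w a)).det := by
  unfold covol
  congr 2
  ext i j
  simp [_root_.gram, ip, PiLp.inner_apply, mul_comm]

/-- The parametrization of the lattice `gℤⁿ` by `ℤⁿ`, with values in Euclidean space. -/
def lattHom (g : Matrix (Fin n) (Fin n) ℝ) : (Fin n → ℤ) →+ EuclideanSpace ℝ (Fin n) where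
  toFun m := WithLp.toLp 2 (g *ᵥ intCast m)
  map_zero' := by
    have : intCast (0 : Fin n → ℤ) = 0 := by ext; simp [intCast]
    simp [this]
  map_add' m m' := by
    have : intCast (m + m') = intCast m + intCast m' := by ext; simp [intCast]
    rw [this, Matrix.mulVec_add, WithLp.toLp_add]

lemma lattHom_apply (g : Matrix (Fin n) (Fin n) ℝ) (m : Fin n → ℤ) :
    lattHom g m = WithLp.toLp 2 (g *ᵥ intCast m) := rfl

lemma toLp_mem_range_lattHom {g : Matrix (Fin n) (Fin n) ℝ} {x : Fin n → ℝ} :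
    WithLp.toLp 2 x ∈ (lattHom g).range ↔ x ∈ latt g := by
  constructor
  · rintro ⟨m, hm⟩
    exact ⟨m, (WithLp.toLp_injective 2 hm).symm⟩
  · rintro ⟨m, rfl⟩
    exact ⟨m, rfl⟩

lemma toEuclideanLin_inv_lattHom {g : Matrix (Fin n) (Fin n) ℝ} (hg : IsUnit g.det)
    (m : Fin n → ℤ) :
    Matrix.toEuclideanLin g⁻¹ (lattHom g m) = WithLp.toLp 2 (intCast m) := by
  rw [lattHom_apply, Matrix.toLpLin_toLp, Matrix.toLin'_apply, Matrix.mulVec_mulVec,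
    Matrix.nonsing_inv_mul g hg, Matrix.one_mulVec]

lemma lattHom_injective {g : Matrix (Fin n) (Fin n) ℝ} (hg : IsUnit g.det) :
    Function.Injective (lattHom g) := by
  intro m m' h
  have h' := congrArg (Matrix.toEuclideanLin g⁻¹) h
  rw [toEuclideanLin_inv_lattHom hg, toEuclideanLin_inv_lattHom hg] at h'
  ext i
  exact Int.cast_injective (α := ℝ) (congrFun (WithLp.toLp_injective 2 h') i)

lemma finite_range_lattHom_norm_le {g : Matrix (Fin n) (Fin n) ℝ} (hg : IsUnit g.det) (r : ℝ) :
    {x | x ∈ (lattHom g).range ∧ ‖x‖ ≤ r}.Finite := by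
  set L := LinearMap.toContinuousLinearMap (Matrix.toEuclideanLin g⁻¹) with hL
  set k : ℤ := ⌈‖L‖ * r⌉
  refine ((Set.finite_Icc (fun _ : Fin n => -k) fun _ => k).image (lattHom g)).subset ?_
  rintro _ ⟨⟨m, rfl⟩, hm⟩
  refine ⟨m, ?_, rfl⟩
  have hbound : ∀ i, |m i| ≤ k := fun i => by
    have h1 := PiLp.norm_apply_le (WithLp.toLp 2 (intCast m) : EuclideanSpace ℝ (Fin n)) i
    have h2 : ‖L (lattHom g m)‖ ≤ ‖L‖ * r := (L.le_opNorm _).trans (by gcongr)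
    rw [hL, LinearMap.coe_toContinuousLinearMap', toEuclideanLin_inv_lattHom hg] at h2
    have h3 : ((|m i| : ℤ) : ℝ) ≤ ‖L‖ * r := by
      rw [Int.cast_abs]
      exact h1.trans h2
    exact_mod_cast h3.trans (Int.le_ceil _)
  exact ⟨fun i => (abs_le.mp (hbound i)).1, fun i => (abs_le.mp (hbound i)).2⟩

lemma one_le_det_gram_intCast {k : ℕ} (m : Fin k → Fin n → ℤ)
    (hm : LinearIndependent ℝ fun a => (WithLp.toLp 2 (intCast (m a)) : EuclideanSpace ℝ (Fin n))) :
    1 ≤ (Matrix.gram ℝ fun a =>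
      (WithLp.toLp 2 (intCast (m a)) : EuclideanSpace ℝ (Fin n))).det := by
  have hpos := (Matrix.posDef_gram_of_linearIndependent hm).det_pos
  have heq : (Matrix.gram ℝ fun a =>
      (WithLp.toLp 2 (intCast (m a)) : EuclideanSpace ℝ (Fin n))) =
      (Matrix.of fun a b => m a ⬝ᵥ m b).map (Int.castRingHom ℝ) := by
    ext a b
    simp [PiLp.inner_apply, intCast, dotProduct, mul_comm]
  rw [heq, ← RingHom.mapMatrix_apply, ← RingHom.map_det] at hpos ⊢
  simp only [eq_intCast] at hpos ⊢
  exact_mod_cast Int.cast_pos.mp hpos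

lemma bddAbove_alphaSet_latt {g : Matrix (Fin n) (Fin n) ℝ} (hg : IsUnit g.det) :
    BddAbove (alphaSet (latt g) ∪ {1}) := by
  set L := LinearMap.toContinuousLinearMap (Matrix.toEuclideanLin g⁻¹) with hL
  refine BddAbove.union ⟨max 1 ‖L‖ ^ n, ?_⟩ bddAbove_singleton
  rintro _ ⟨i, -, hin, w, hw, hli, -, rfl⟩
  choose m hm using hw
  set W : Fin i → EuclideanSpace ℝ (Fin n) := fun a => WithLp.toLp 2 (w a) with hW
  have hWli : LinearIndependent ℝ W :=
    hli.map' (WithLp.linearEquiv 2 ℝ (Fin n → ℝ)).symm.toLinearMap (LinearEquiv.ker _)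
  have hLW : L ∘ W = fun a => WithLp.toLp 2 (intCast (m a)) := by
    funext a
    rw [← toEuclideanLin_inv_lattHom hg, lattHom_apply, ← hm]
    rfl
  have hLWli : LinearIndependent ℝ (L ∘ W) := by
    refine hWli.map' L.toLinearMap (LinearMap.ker_eq_bot.mpr ?_)
    refine Function.LeftInverse.injective (g := Matrix.toEuclideanLin g) fun x => ?_
    simp [hL, Matrix.toLpLin_apply, Matrix.mulVec_mulVec, Matrix.mul_nonsing_inv g hg]
  have h1 : 1 ≤ (Matrix.gram ℝ (L ∘ W)).det := by
    rw [hLW] at hLWli ⊢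
    exact one_le_det_gram_intCast m hLWli
  have h2 := (Matrix.posDef_gram_of_linearIndependent hLWli).det_le_det_add
    (Matrix.posSemidef_opNorm_smul_gram_sub_gram W L)
  rw [add_sub_cancel, Matrix.det_smul, Fintype.card_fin] at h2
  have hdet := (Matrix.posDef_gram_of_linearIndependent hWli).det_pos
  have hcov : covol w = √(Matrix.gram ℝ W).det := covol_eq_sqrt_det_gram w
  have hcovpos : 0 < covol w := hcov ▸ Real.sqrt_pos.mpr hdet
  have hsq : covol w ^ 2 = (Matrix.gram ℝ W).det := by rw [hcov, Real.sq_sqrt hdet.le]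
  have h3 : 1 ≤ ‖L‖ ^ i * covol w := by
    refine (one_le_sq_iff₀ (by positivity)).mp ?_
    calc (1 : ℝ) ≤ _ := h1.trans h2
      _ = _ := by rw [← hsq]; ring
  calc (covol w)⁻¹ ≤ ‖L‖ ^ i := (inv_le_iff_one_le_mul₀ hcovpos).mpr h3
    _ ≤ max 1 ‖L‖ ^ i := by gcongr; exact le_max_right _ _
    _ ≤ max 1 ‖L‖ ^ n := pow_le_pow_right₀ (le_max_left _ _) hin

/-- Points of a translated lattice in a ball are counted by `α`. -/
theorem ncard_le_mul_alphaFn {g : Matrix (Fin n) (Fin n) ℝ} (hg : IsUnit g.det) {R : ℝ}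
    (hR : 1 ≤ R) (ξ : EuclideanSpace ℝ (Fin n)) :
    ({x | x ∈ (lattHom g).range ∧ ‖x + ξ‖ ≤ R}.ncard : ℝ) ≤
      (6 * R) ^ n * alphaFn (latt g) := by
  obtain ⟨i, W, hWΛ, hWli, hWprim, hWcard⟩ := exists_primitive_ncard_mul_sqrt_det_gram_le R _
    (lattHom g).range (finite_range_lattHom_norm_le hg) le_rfl
  have hin : i ≤ n := by simpa using hWli.fintype_card_le_finrank
  set w : Fin i → Fin n → ℝ := fun a => (W a).ofLp with hw
  have hcov : covol w = √(Matrix.gram ℝ W).det := covol_eq_sqrt_det_gram w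
  have hcovpos : 0 < covol w :=
    hcov ▸ Real.sqrt_pos.mpr (Matrix.posDef_gram_of_linearIndependent hWli).det_pos
  have hmem : (covol w)⁻¹ ∈ alphaSet (latt g) ∪ {1} := by
    rcases Nat.eq_zero_or_pos i with rfl | hi
    · right
      rw [hcov, Matrix.det_fin_zero]
      simp
    · left
      refine ⟨i, hi, hin, w, fun a => toLp_mem_range_lattHom.mp (hWΛ a), ?_, ?_, rfl⟩
      · exact hWli.map' (WithLp.linearEquiv 2 ℝ (Fin n → ℝ)).toLinearMap (LinearEquiv.ker _)
      · intro x hx hxs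
        have h := Submodule.mem_map_of_mem
          (f := (WithLp.linearEquiv 2 ℝ (Fin n → ℝ)).symm.toLinearMap) hxs
        rw [Submodule.map_span, ← Set.range_comp] at h
        obtain ⟨c, hc⟩ := hWprim (WithLp.toLp 2 x) (toLp_mem_range_lattHom.mpr hx) h
        refine ⟨c, ?_⟩
        have h' := congrArg (WithLp.linearEquiv 2 ℝ (Fin n → ℝ)) hc
        rw [map_sum] at h'
        simpa using h'
  have hα : (covol w)⁻¹ ≤ alphaFn (latt g) := le_csSup (bddAbove_alphaSet_latt hg) hmem
  have hcard := hWcard ξ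
  rw [← hcov, ← le_div_iff₀ hcovpos, div_eq_mul_inv] at hcard
  calc _ ≤ (6 * R) ^ i * (covol w)⁻¹ := hcard
    _ ≤ (6 * R) ^ n * alphaFn (latt g) := by
      gcongr
      linarith

end Euclidean

theorem stmt_8 (n : ℕ) (hn : 1 ≤ n)
    (f : (Fin n → ℝ) → ℝ) (hf : Continuous f) (hsupp : HasCompactSupport f) :
    ∃ c : ℝ, 0 < c ∧ ∀ (g : Matrix (Fin n) (Fin n) ℝ), g.det = 1 →
      ∀ ξ : Fin n → ℝ,
        |∑' m : Fin n → ℤ, f (g *ᵥ intCast m + ξ)| < c * alphaFn (latt g) := by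
  obtain ⟨M, hM⟩ := hsupp.exists_bound_of_continuous hf
  obtain ⟨R₀, hR₀⟩ := (hsupp.isCompact.image
    (PiLp.continuous_toLp 2 (fun _ : Fin n => ℝ))).isBounded.exists_norm_le
  set R := max 1 R₀
  have hR : 1 ≤ R := le_max_left _ _
  have hfR : ∀ x, R < ‖(WithLp.toLp 2 x : EuclideanSpace ℝ (Fin n))‖ → f x = 0 := fun x hx => by
    by_contra h
    exact absurd ((hR₀ _ ⟨x, subset_tsupport f h, rfl⟩).trans (le_max_right 1 R₀)) hx.not_ge
  have hM0 : 0 ≤ M := (norm_nonneg _).trans (hM 0)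
  refine ⟨(M + 1) * (6 * R) ^ n, by positivity, fun g hg ξ => ?_⟩
  have hgu : IsUnit g.det := hg ▸ isUnit_one
  have hS := finite_setOf_norm_add_le (finite_range_lattHom_norm_le hgu) (WithLp.toLp 2 ξ) R
  have hA : {m | ‖lattHom g m + WithLp.toLp 2 ξ‖ ≤ R}.Finite :=
    (hS.preimage (lattHom_injective hgu).injOn).subset fun m hm => ⟨⟨m, rfl⟩, hm⟩
  have hAcard : hA.toFinset.card ≤
      {x | x ∈ (lattHom g).range ∧ ‖x + WithLp.toLp 2 ξ‖ ≤ R}.ncard := by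
    rw [Set.ncard_eq_toFinset_card _ hS]
    refine Finset.card_le_card_of_injOn (lattHom g) (fun m hm => ?_)
      (lattHom_injective hgu).injOn
    simp only [Set.Finite.coe_toFinset, Set.mem_ofPred_eq] at hm ⊢
    exact ⟨⟨m, rfl⟩, hm⟩
  have htsum : ∑' m : Fin n → ℤ, f (g *ᵥ intCast m + ξ) =
      ∑ m ∈ hA.toFinset, f (g *ᵥ intCast m + ξ) := by
    refine tsum_eq_sum fun m hm => hfR _ ?_
    rw [Set.Finite.mem_toFinset, Set.mem_ofPred_eq, not_le] at hm
    exact hm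
  have hα : 1 ≤ alphaFn (latt g) := le_csSup (bddAbove_alphaSet_latt hgu) (Or.inr rfl)
  have hK := ncard_le_mul_alphaFn hgu hR (WithLp.toLp 2 ξ)
  have hpos : 0 < (6 * R) ^ n * alphaFn (latt g) := by positivity
  calc |∑' m : Fin n → ℤ, f (g *ᵥ intCast m + ξ)|
      ≤ ∑ m ∈ hA.toFinset, |f (g *ᵥ intCast m + ξ)| := by
        rw [htsum]
        exact Finset.abs_sum_le_sum_abs _ _
    _ ≤ hA.toFinset.card * M := by
        rw [← nsmul_eq_mul]
        exact Finset.sum_le_card_nsmul _ _ _ fun m _ => hM _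
    _ ≤ ((6 * R) ^ n * alphaFn (latt g)) * M := by
        gcongr
        exact (Nat.cast_le.mpr hAcard).trans hK
    _ < (M + 1) * (6 * R) ^ n * alphaFn (latt g) := by
        linarith

end
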